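/- arXiv:0902.2260 — 14 statements merged into one kernel-verified Lean document; each statement's English description precedes it below -/
import Mathlib

section
/- Theorem 1 (Achievable rate region of TDMH): The TDMH rate region R_TDMH equals the convex hull of the three points (0,0), (Σ_AB, 0) and (0, Σ_BA); that is, R_TDMH = {(x,y) ∈ ℝ² : x ≥ 0, y ≥ 0, x/Σ_AB + y/Σ_BA ≤ 1}. -/
/-- The right triangle with legs `a` and `b` on the coordinate axes, as a convex hull. -/
theorem convexHull_right_triangle {a b : ℝ} (ha : 0 < a) (hb : 0 < b) :
    convexHull ℝ {((0 : ℝ), (0 : ℝ)), (a, 0), (0, b)} =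
      {p : ℝ × ℝ | 0 ≤ p.1 ∧ 0 ≤ p.2 ∧ p.1 / a + p.2 / b ≤ 1} := by
  apply Set.Subset.antisymm
  · refine convexHull_min ?_ ?_
    · rintro p (rfl | rfl | rfl)
      · simp
      · simp [ha.le, ha.ne']
      · simp [hb.le, hb.ne']
    · rintro ⟨x, y⟩ ⟨hx, hy, hxy⟩ ⟨x', y'⟩ ⟨hx', hy', hxy'⟩ s t hs ht hst
      dsimp only at hx hy hxy hx' hy' hxy'
      refine ⟨by simp; positivity, by simp; positivity, ?_⟩
      simp only [Prod.smul_mk, Prod.mk_add_mk, smul_eq_mul]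
      calc (s * x + t * x') / a + (s * y + t * y') / b
          = s * (x / a + y / b) + t * (x' / a + y' / b) := by ring
        _ ≤ s * 1 + t * 1 := by gcongr
        _ = 1 := by rw [mul_one, mul_one, hst]
  · rintro ⟨x, y⟩ ⟨hx, hy, hxy⟩
    dsimp only at hx hy hxy
    have hmem : ∀ q ∈ ({((0 : ℝ), (0 : ℝ)), (a, 0), (0, b)} : Set (ℝ × ℝ)),
        q ∈ convexHull ℝ {((0 : ℝ), (0 : ℝ)), (a, 0), (0, b)} := subset_convexHull ℝ _
    have h := (convex_convexHull ℝ {((0 : ℝ), (0 : ℝ)), (a, 0), (0, b)}).sum_mem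
      (t := Finset.univ) (w := ![1 - (x / a + y / b), x / a, y / b])
      (z := ![(0, 0), (a, 0), (0, b)])
      (fun i _ => by fin_cases i <;> simp <;> first | positivity | linarith)
      (by simp [Fin.sum_univ_three]; ring)
      (fun i _ => hmem _ (by fin_cases i <;> simp))
    simpa [Fin.sum_univ_three, ha.ne', hb.ne'] using h

/-- Time shares `u`, `v` supporting rate `x` over two consecutive links of capacities `c`, `d`
have total length at least `x * (1 / c + 1 / d)`. -/
theorem mul_add_inv_le_add {c d x u v : ℝ} (hc : 0 < c) (hd : 0 < d)
    (hu : x ≤ u * c) (hv : x ≤ v * d) : x * (1 / c + 1 / d) ≤ u + v := by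
  have h₁ : x / c ≤ u := (div_le_iff₀ hc).2 hu
  have h₂ : x / d ≤ v := (div_le_iff₀ hd).2 hv
  calc x * (1 / c + 1 / d) = x / c + x / d := by ring
    _ ≤ u + v := add_le_add h₁ h₂

/-- Theorem 1 (Achievable rate region of TDMH): `R_TDMH` is the convex hull (a triangle)
of `(0,0)`, `(Σ_AB, 0)`, `(0, Σ_BA)`, i.e. the set
`{(x,y) : x ≥ 0, y ≥ 0, x/Σ_AB + y/Σ_BA ≤ 1}`. -/
theorem tdmh_rate_region (C_AD C_DB C_BD C_DA : ℝ)
    (hAD : 0 < C_AD) (hDB : 0 < C_DB) (hBD : 0 < C_BD) (hDA : 0 < C_DA) :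
    let S_AB : ℝ := (1 / C_AD + 1 / C_DB)⁻¹
    let S_BA : ℝ := (1 / C_BD + 1 / C_DA)⁻¹
    let R_TDMH : Set (ℝ × ℝ) := {p | 0 ≤ p.1 ∧ 0 ≤ p.2 ∧
      ∃ l1 l2 l3 l4 : ℝ, l1 ∈ Set.Icc (0 : ℝ) 1 ∧ l2 ∈ Set.Icc (0 : ℝ) 1 ∧
        l3 ∈ Set.Icc (0 : ℝ) 1 ∧ l4 ∈ Set.Icc (0 : ℝ) 1 ∧
        l1 + l2 + l3 + l4 = 1 ∧
        p.1 ≤ l1 * C_AD ∧ p.1 ≤ l2 * C_DB ∧ p.2 ≤ l3 * C_BD ∧ p.2 ≤ l4 * C_DA}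
    R_TDMH = convexHull ℝ {((0 : ℝ), (0 : ℝ)), (S_AB, 0), (0, S_BA)} ∧
    R_TDMH = {p : ℝ × ℝ | 0 ≤ p.1 ∧ 0 ≤ p.2 ∧ p.1 / S_AB + p.2 / S_BA ≤ 1} := by
  intro S_AB S_BA R_TDMH
  have hR : R_TDMH = {p : ℝ × ℝ | 0 ≤ p.1 ∧ 0 ≤ p.2 ∧ p.1 / S_AB + p.2 / S_BA ≤ 1} := by
    ext ⟨x, y⟩
    simp only [R_TDMH, S_AB, S_BA, Set.mem_ofPred_eq, div_inv_eq_mul]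
    refine and_congr_right fun hx => and_congr_right fun hy => ⟨?_, fun h => ?_⟩
    · rintro ⟨l1, l2, l3, l4, -, -, -, -, hsum, h1, h2, h3, h4⟩
      linarith [mul_add_inv_le_add hAD hDB h1 h2, mul_add_inv_le_add hBD hDA h3 h4]
    · have h1 : 0 ≤ x / C_AD := by positivity
      have h2 : 0 ≤ x / C_DB := by positivity
      have h3 : 0 ≤ y / C_BD := by positivity
      have h4 : 0 ≤ y / C_DA := by positivity
      have hsum : x / C_AD + x / C_DB + y / C_BD + y / C_DA ≤ 1 := by
        convert h using 1
        ring
      refine ⟨x / C_AD, x / C_DB, y / C_BD, 1 - (x / C_AD + x / C_DB + y / C_BD),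
        ⟨h1, by linarith⟩, ⟨h2, by linarith⟩, ⟨h3, by linarith⟩,
        ⟨by linarith, by linarith⟩, by ring, (div_mul_cancel₀ x hAD.ne').ge,
        (div_mul_cancel₀ x hDB.ne').ge, (div_mul_cancel₀ y hBD.ne').ge,
        (div_le_iff₀ hDA).1 (by linarith)⟩
  refine ⟨hR.trans (convexHull_right_triangle ?_ ?_).symm, hR⟩ <;> positivity
end

section
/- Theorem 2, first case (Achievable rate region of MLNC when C_DB ≤ C_DA): If C_DB ≤ C_DA, then the MLNC rate region R_MLNC equals the convex hull of the four points (0,0), (Σ_AB, 0), (Σ_min, Σ_min) and (0, Σ_BB); equivalently, R_MLNC = {(x,y) ∈ ℝ² : x ≥ 0, y ≥ 0, x/Σ_AB + y/C_BD ≤ 1 and x/C_AD + y/Σ_BB ≤ 1}. -/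
/-- The polygon cut out of the nonnegative quadrant by `(a + d) x + b y ≤ 1` and
`a x + (b + d) y ≤ 1` is the convex hull of its vertices. -/
theorem convexHull_quadrant_polygon {a b d : ℝ} (ha : 0 < a) (hb : 0 < b) (hd : 0 < d) :
    convexHull ℝ {((0 : ℝ), (0 : ℝ)), ((a + d)⁻¹, 0),
      ((a + b + d)⁻¹, (a + b + d)⁻¹), (0, (b + d)⁻¹)} =
    {p : ℝ × ℝ | 0 ≤ p.1 ∧ 0 ≤ p.2 ∧
      p.1 * (a + d) + p.2 * b ≤ 1 ∧ p.1 * a + p.2 * (b + d) ≤ 1} := by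
  have had : 0 < a + d := by positivity
  have hbd : 0 < b + d := by positivity
  have habd : 0 < a + b + d := by positivity
  apply Set.Subset.antisymm
  · apply convexHull_min
    · rintro p (rfl | rfl | rfl | rfl)
      · simp
      · refine ⟨by positivity, le_rfl, ?_, ?_⟩ <;> dsimp only <;> field_simp <;> linarith
      · refine ⟨by positivity, by positivity, ?_, ?_⟩ <;> dsimp only <;> field_simp <;> linarith
      · refine ⟨le_rfl, by positivity, ?_, ?_⟩ <;> dsimp only <;> field_simp <;> linarith
    · rintro ⟨x, y⟩ ⟨h1, h2, h3, h4⟩ ⟨u, v⟩ ⟨g1, g2, g3, g4⟩ s t hs ht hst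
      dsimp only at *
      refine ⟨?_, ?_, ?_, ?_⟩ <;>
        simp only [Prod.smul_mk, Prod.mk_add_mk, smul_eq_mul]
      · positivity
      · positivity
      · nlinarith [mul_le_mul_of_nonneg_left h3 hs, mul_le_mul_of_nonneg_left g3 ht]
      · nlinarith [mul_le_mul_of_nonneg_left h4 hs, mul_le_mul_of_nonneg_left g4 ht]
  · rintro ⟨x, y⟩ ⟨hx, hy, h1, h2⟩
    dsimp only at *
    set s : Set (ℝ × ℝ) := {((0 : ℝ), (0 : ℝ)), ((a + d)⁻¹, 0),
      ((a + b + d)⁻¹, (a + b + d)⁻¹), (0, (b + d)⁻¹)} with hs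
    have combo : ∀ q ∈ s, ∀ r ∈ s, ∀ u v : ℝ, 0 ≤ u → 0 ≤ v → u + v ≤ 1 →
        u • q + v • r ∈ convexHull ℝ s := by
      intro q hq r hr u v hu hv huv
      have h := (convex_convexHull ℝ s).sum_mem (t := Finset.univ)
        (w := ![u, v, 1 - u - v]) (z := ![q, r, 0])
        (by intro i _; fin_cases i <;> simp <;> linarith)
        (by simp [Fin.sum_univ_three])
        (by
          intro i _
          apply subset_convexHull
          fin_cases i
          · exact hq
          · exact hr
          · exact Or.inl rfl)
      simpa [Fin.sum_univ_three] using h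
    rcases le_total y x with h | h
    · convert combo ((a + b + d)⁻¹, (a + b + d)⁻¹) (by simp [hs]) ((a + d)⁻¹, 0) (by simp [hs])
        (y * (a + b + d)) ((x - y) * (a + d)) (by positivity)
        (mul_nonneg (sub_nonneg.2 h) had.le) (by linarith) using 1
      ext <;> simp <;> field_simp; ring
    · convert combo ((a + b + d)⁻¹, (a + b + d)⁻¹) (by simp [hs]) (0, (b + d)⁻¹) (by simp [hs])
        (x * (a + b + d)) ((y - x) * (b + d)) (by positivity)
        (mul_nonneg (sub_nonneg.2 h) hbd.le) (by linarith) using 1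
      ext <;> simp <;> field_simp; ring

/-- A rate pair admits a time-sharing schedule over three phases iff the two linear constraints
hold. -/
theorem exists_schedule_iff {A B D x y : ℝ} (hA : 0 < A) (hB : 0 < B) (hD : 0 < D)
    (hx : 0 ≤ x) (hy : 0 ≤ y) :
    (∃ l1 l2 l3 : ℝ, l1 ∈ Set.Icc (0 : ℝ) 1 ∧ l2 ∈ Set.Icc (0 : ℝ) 1 ∧
        l3 ∈ Set.Icc (0 : ℝ) 1 ∧ l1 + l2 + l3 = 1 ∧
        x ≤ l1 * A ∧ x ≤ l3 * D ∧ y ≤ l2 * B ∧ y ≤ l3 * D) ↔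
      x * (1 / A + 1 / D) + y * (1 / B) ≤ 1 ∧ x * (1 / A) + y * (1 / B + 1 / D) ≤ 1 := by
  simp only [mul_add, mul_one_div]
  have hxA : 0 ≤ x / A := by positivity
  have hyB : 0 ≤ y / B := by positivity
  have hxD : 0 ≤ x / D := by positivity
  have hyD : 0 ≤ y / D := by positivity
  constructor
  · rintro ⟨l1, l2, l3, -, -, -, hsum, h1, h2, h3, h4⟩
    rw [← div_le_iff₀ hA] at h1
    rw [← div_le_iff₀ hD] at h2 h4
    rw [← div_le_iff₀ hB] at h3
    constructor <;> linarith
  · rintro ⟨h1, h2⟩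
    refine ⟨x / A, y / B, 1 - x / A - y / B, ⟨hxA, by linarith⟩, ⟨hyB, by linarith⟩,
      ⟨by linarith, by linarith⟩, by ring, ?_, ?_, ?_, ?_⟩
    · rw [div_mul_cancel₀ _ hA.ne']
    · rw [← div_le_iff₀ hD]; linarith
    · rw [div_mul_cancel₀ _ hB.ne']
    · rw [← div_le_iff₀ hD]; linarith


/-- Theorem 2, first case (Achievable rate region of MLNC when `C_DB ≤ C_DA`):
`R_MLNC` is the convex hull of `(0,0)`, `(Σ_AB,0)`, `(Σ_min,Σ_min)`, `(0,Σ_BB)`,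
i.e. `{(x,y) : x ≥ 0, y ≥ 0, x/Σ_AB + y/C_BD ≤ 1, x/C_AD + y/Σ_BB ≤ 1}`. -/
theorem mlnc_rate_region_of_le (C_AD C_DB C_BD C_DA : ℝ)
    (hAD : 0 < C_AD) (hDB : 0 < C_DB) (hBD : 0 < C_BD) (hDA : 0 < C_DA)
    (hle : C_DB ≤ C_DA) :
    let C_min : ℝ := min C_DA C_DB
    let S_AB : ℝ := (1 / C_AD + 1 / C_DB)⁻¹
    let S_BB : ℝ := (1 / C_BD + 1 / C_DB)⁻¹
    let S_min : ℝ := (1 / C_AD + 1 / C_BD + 1 / C_min)⁻¹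
    let R_MLNC : Set (ℝ × ℝ) := {p | 0 ≤ p.1 ∧ 0 ≤ p.2 ∧
      ∃ l1 l2 l3 : ℝ, l1 ∈ Set.Icc (0 : ℝ) 1 ∧ l2 ∈ Set.Icc (0 : ℝ) 1 ∧
        l3 ∈ Set.Icc (0 : ℝ) 1 ∧ l1 + l2 + l3 = 1 ∧
        p.1 ≤ l1 * C_AD ∧ p.1 ≤ l3 * C_min ∧ p.2 ≤ l2 * C_BD ∧ p.2 ≤ l3 * C_min}
    R_MLNC = convexHull ℝ {((0 : ℝ), (0 : ℝ)), (S_AB, 0), (S_min, S_min), (0, S_BB)} ∧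
    R_MLNC = {p : ℝ × ℝ | 0 ≤ p.1 ∧ 0 ≤ p.2 ∧
      p.1 / S_AB + p.2 / C_BD ≤ 1 ∧ p.1 / C_AD + p.2 / S_BB ≤ 1} := by
  intro C_min S_AB S_BB S_min R_MLNC
  have hmin : C_min = C_DB := min_eq_right hle
  have hR : R_MLNC = {p : ℝ × ℝ | 0 ≤ p.1 ∧ 0 ≤ p.2 ∧
      p.1 * (1 / C_AD + 1 / C_DB) + p.2 * (1 / C_BD) ≤ 1 ∧
      p.1 * (1 / C_AD) + p.2 * (1 / C_BD + 1 / C_DB) ≤ 1} := by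
    ext p
    simp only [R_MLNC, hmin, Set.mem_ofPred_eq]
    exact and_congr_right fun hx => and_congr_right fun hy =>
      exists_schedule_iff hAD hBD hDB hx hy
  constructor
  · rw [hR, ← convexHull_quadrant_polygon (one_div_pos.2 hAD) (one_div_pos.2 hBD)
      (one_div_pos.2 hDB)]
    simp only [S_AB, S_BB, S_min, hmin]
  · rw [hR]
    simp only [S_AB, S_BB, div_inv_eq_mul, mul_one_div]
end

section
/- Theorem 2, second case (Achievable rate region of MLNC when C_DB > C_DA): If C_DB > C_DA, then the MLNC rate region R_MLNC equals the convex hull of the four points (0,0), (Σ_AA, 0), (Σ_min, Σ_min) and (0, Σ_BA); equivalently, R_MLNC = {(x,y) ∈ ℝ² : x ≥ 0, y ≥ 0, x/Σ_AA + y/C_BD ≤ 1 and x/C_AD + y/Σ_BA ≤ 1}. -/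
/-- A convex set containing `0`, `u` and `v` contains every subconvex combination of `u`, `v`. -/
theorem Convex.add_smul_mem_of_zero_mem {E : Type*} [AddCommGroup E] [Module ℝ E] {s : Set E}
    (hs : Convex ℝ s) (h0 : (0 : E) ∈ s) {u v : E} (hu : u ∈ s) (hv : v ∈ s) {r t : ℝ}
    (hr : 0 ≤ r) (ht : 0 ≤ t) (hrt : r + t ≤ 1) : r • u + t • v ∈ s := by
  have h := hs.sum_mem (t := Finset.univ) (w := ![1 - r - t, r, t]) (z := ![0, u, v])
    (by intro i _; fin_cases i <;> simp <;> linarith)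
    (by simp [Fin.sum_univ_three]; ring)
    (by intro i _; fin_cases i <;> simp [h0, hu, hv])
  simpa [Fin.sum_univ_three] using h

/-- The quadrilateral cut out by `(a + c) x + b y ≤ 1` and `a x + (b + c) y ≤ 1` in the positive
quadrant is the convex hull of its vertices. -/
theorem quadrilateral_eq_convexHull {a b c : ℝ} (ha : 0 < a) (hb : 0 < b) (hc : 0 < c) :
    {p : ℝ × ℝ | 0 ≤ p.1 ∧ 0 ≤ p.2 ∧ (a + c) * p.1 + b * p.2 ≤ 1 ∧ a * p.1 + (b + c) * p.2 ≤ 1} =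
      convexHull ℝ {((0 : ℝ), (0 : ℝ)), ((a + c)⁻¹, 0), ((a + b + c)⁻¹, (a + b + c)⁻¹),
        (0, (b + c)⁻¹)} := by
  apply Set.Subset.antisymm
  · rintro ⟨x, y⟩ ⟨hx, hy, h1, h2⟩
    dsimp only at hx hy h1 h2
    set V : Set (ℝ × ℝ) := {((0 : ℝ), (0 : ℝ)), ((a + c)⁻¹, 0),
      ((a + b + c)⁻¹, (a + b + c)⁻¹), (0, (b + c)⁻¹)} with hV
    have hconv := convex_convexHull ℝ V
    have h0 : (0 : ℝ × ℝ) ∈ convexHull ℝ V :=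
      subset_convexHull ℝ V (by rw [hV]; exact Or.inl rfl)
    have hA : ((a + c)⁻¹, (0 : ℝ)) ∈ convexHull ℝ V := subset_convexHull ℝ V (by simp [hV])
    have hM : ((a + b + c)⁻¹, (a + b + c)⁻¹) ∈ convexHull ℝ V :=
      subset_convexHull ℝ V (by simp [hV])
    have hB : ((0 : ℝ), (b + c)⁻¹) ∈ convexHull ℝ V := subset_convexHull ℝ V (by simp [hV])
    rcases le_total y x with hyx | hxy
    · have hxy' : 0 ≤ x - y := sub_nonneg.2 hyx
      convert hconv.add_smul_mem_of_zero_mem h0 hA hM (r := (a + c) * (x - y))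
        (t := (a + b + c) * y) (by positivity) (by positivity) (by linarith) using 1
      ext <;> simp <;> field_simp
      ring
    · have hyx' : 0 ≤ y - x := sub_nonneg.2 hxy
      convert hconv.add_smul_mem_of_zero_mem h0 hB hM (r := (b + c) * (y - x))
        (t := (a + b + c) * x) (by positivity) (by positivity) (by linarith) using 1
      ext <;> simp <;> field_simp
      ring
  · apply convexHull_min
    · rintro p (rfl | rfl | rfl | rfl)
      · simp
      · refine ⟨by positivity, le_rfl, ?_, ?_⟩ <;> field_simp <;> linarith
      · refine ⟨by positivity, by positivity, ?_, ?_⟩ <;> field_simp <;> linarith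
      · refine ⟨le_rfl, by positivity, ?_, ?_⟩ <;> field_simp <;> linarith
    · rintro ⟨x, y⟩ ⟨hx, hy, h1, h2⟩ ⟨x', y'⟩ ⟨hx', hy', h1', h2'⟩ r t hr ht hrt
      dsimp only at hx hy h1 h2 hx' hy' h1' h2'
      refine ⟨?_, ?_, ?_, ?_⟩ <;> simp only [Prod.smul_mk, Prod.mk_add_mk, smul_eq_mul]
      · positivity
      · positivity
      · linarith [mul_le_mul_of_nonneg_left h1 hr, mul_le_mul_of_nonneg_left h1' ht]
      · linarith [mul_le_mul_of_nonneg_left h2 hr, mul_le_mul_of_nonneg_left h2' ht]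


/-- Theorem 2, second case (Achievable rate region of MLNC when `C_DB > C_DA`):
`R_MLNC` is the convex hull of `(0,0)`, `(Σ_AA,0)`, `(Σ_min,Σ_min)`, `(0,Σ_BA)`,
i.e. `{(x,y) : x ≥ 0, y ≥ 0, x/Σ_AA + y/C_BD ≤ 1, x/C_AD + y/Σ_BA ≤ 1}`. -/
theorem mlnc_rate_region_of_gt (C_AD C_DB C_BD C_DA : ℝ)
    (hAD : 0 < C_AD) (hDB : 0 < C_DB) (hBD : 0 < C_BD) (hDA : 0 < C_DA)
    (hgt : C_DA < C_DB) :
    let C_min : ℝ := min C_DA C_DB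
    let S_AA : ℝ := (1 / C_AD + 1 / C_DA)⁻¹
    let S_BA : ℝ := (1 / C_BD + 1 / C_DA)⁻¹
    let S_min : ℝ := (1 / C_AD + 1 / C_BD + 1 / C_min)⁻¹
    let R_MLNC : Set (ℝ × ℝ) := {p | 0 ≤ p.1 ∧ 0 ≤ p.2 ∧
      ∃ l1 l2 l3 : ℝ, l1 ∈ Set.Icc (0 : ℝ) 1 ∧ l2 ∈ Set.Icc (0 : ℝ) 1 ∧
        l3 ∈ Set.Icc (0 : ℝ) 1 ∧ l1 + l2 + l3 = 1 ∧
        p.1 ≤ l1 * C_AD ∧ p.1 ≤ l3 * C_min ∧ p.2 ≤ l2 * C_BD ∧ p.2 ≤ l3 * C_min}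
    R_MLNC = convexHull ℝ {((0 : ℝ), (0 : ℝ)), (S_AA, 0), (S_min, S_min), (0, S_BA)} ∧
    R_MLNC = {p : ℝ × ℝ | 0 ≤ p.1 ∧ 0 ≤ p.2 ∧
      p.1 / S_AA + p.2 / C_BD ≤ 1 ∧ p.1 / C_AD + p.2 / S_BA ≤ 1} := by
  intro C_min S_AA S_BA S_min R_MLNC
  have hmin : C_min = C_DA := min_eq_left hgt.le
  have ha : 0 < 1 / C_AD := by positivity
  have hb : 0 < 1 / C_BD := by positivity
  have hc : 0 < 1 / C_DA := by positivity
  have hpoly : {p : ℝ × ℝ | 0 ≤ p.1 ∧ 0 ≤ p.2 ∧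
      p.1 / S_AA + p.2 / C_BD ≤ 1 ∧ p.1 / C_AD + p.2 / S_BA ≤ 1} =
      {p : ℝ × ℝ | 0 ≤ p.1 ∧ 0 ≤ p.2 ∧ (1 / C_AD + 1 / C_DA) * p.1 + 1 / C_BD * p.2 ≤ 1 ∧
        1 / C_AD * p.1 + (1 / C_BD + 1 / C_DA) * p.2 ≤ 1} := by
    ext p
    simp only [S_AA, S_BA, Set.mem_ofPred_eq, div_inv_eq_mul, mul_comm p.1, mul_comm p.2,
      one_div_mul_eq_div]
  have hR : R_MLNC = {p : ℝ × ℝ | 0 ≤ p.1 ∧ 0 ≤ p.2 ∧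
      p.1 / S_AA + p.2 / C_BD ≤ 1 ∧ p.1 / C_AD + p.2 / S_BA ≤ 1} := by
    rw [hpoly]
    ext ⟨x, y⟩
    simp only [R_MLNC, hmin, Set.mem_ofPred_eq, Set.mem_Icc, ← div_le_iff₀ hAD, ← div_le_iff₀ hBD,
      ← div_le_iff₀ hDA, add_mul, one_div_mul_eq_div]
    refine and_congr_right fun hx => and_congr_right fun hy => ⟨?_, ?_⟩
    · rintro ⟨l1, l2, l3, -, -, -, hsum, h1, h2, h3, h4⟩
      constructor <;> linarith
    · rintro ⟨h1, h2⟩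
      have hxA : 0 ≤ x / C_AD := by positivity
      have hyB : 0 ≤ y / C_BD := by positivity
      have hxD : 0 ≤ x / C_DA := by positivity
      have hyD : 0 ≤ y / C_DA := by positivity
      refine ⟨x / C_AD, y / C_BD, 1 - x / C_AD - y / C_BD, ⟨?_, ?_⟩, ⟨?_, ?_⟩, ⟨?_, ?_⟩,
        ?_, ?_, ?_, ?_, ?_⟩ <;> linarith
  refine ⟨?_, hR⟩
  rw [hR, hpoly, quadrilateral_eq_convexHull ha hb hc]
  simp only [S_AA, S_BA, S_min, hmin]
end

section
/- Theorem 3 (Achievable rate region of PLNC): The PLNC rate region R_PLNC equals the convex hull of the four points (0,0), (Σ_AB, 0), (Σ_ABA, Σ_BAB) and (0, Σ_BA); equivalently, R_PLNC = {(x,y) ∈ ℝ² : x ≥ 0, y ≥ 0, x/C_AD + y/C_BD + max{x/C_DB, y/C_DA} ≤ 1}. -/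
/-- A convex set containing the origin contains every subconvex combination of two of its points. -/
lemma Convex.add_smul_mem_of_zero_mem_s3 {E : Type*} [AddCommGroup E] [Module ℝ E] {s : Set E}
    (hs : Convex ℝ s) (h0 : 0 ∈ s) {p q : E} (hp : p ∈ s) (hq : q ∈ s) {a b : ℝ} (ha : 0 ≤ a) (hb : 0 ≤ b)
    (hab : a + b ≤ 1) : a • p + b • q ∈ s := by
  have h := hs.sum_mem (t := Finset.univ) (w := ![1 - (a + b), a, b]) (z := ![0, p, q])
    (by simp [Fin.forall_fin_succ, ha, hb, hab]) (by simp [Fin.sum_univ_three]; ring)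
    (by simp [Fin.forall_fin_succ, hp, hq, h0])
  simpa [Fin.sum_univ_three] using h

/-- Elimination of the time shares: a rate pair is achievable iff the minimal shares fit. -/
lemma exists_time_shares_iff {A B C D x y : ℝ} (hA : 0 < A) (hB : 0 < B) (hC : 0 < C)
    (hD : 0 < D) (hx : 0 ≤ x) (hy : 0 ≤ y) :
    (∃ l1 l2 l3 : ℝ, l1 ∈ Set.Icc (0 : ℝ) 1 ∧ l2 ∈ Set.Icc (0 : ℝ) 1 ∧
      l3 ∈ Set.Icc (0 : ℝ) 1 ∧ l1 + l2 + l3 = 1 ∧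
      x ≤ l1 * A ∧ x ≤ l3 * B ∧ y ≤ l2 * C ∧ y ≤ l3 * D) ↔
    x / A + y / C + max (x / B) (y / D) ≤ 1 := by
  constructor
  · rintro ⟨l1, l2, l3, -, -, -, hl, h1, h2, h3, h4⟩
    rw [← div_le_iff₀ ‹_›] at h1 h2 h3 h4
    linarith [max_le h2 h4]
  · intro h
    have hxA : 0 ≤ x / A := by positivity
    have hyC : 0 ≤ y / C := by positivity
    have hxB : 0 ≤ x / B := by positivity
    have hxm := le_max_left (x / B) (y / D)
    have hym := le_max_right (x / B) (y / D)
    refine ⟨x / A, y / C, 1 - x / A - y / C, ⟨hxA, by linarith⟩, ⟨hyC, by linarith⟩,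
      ⟨by linarith, by linarith⟩, by ring, (div_le_iff₀ hA).1 le_rfl,
      (div_le_iff₀ hB).1 (by linarith), (div_le_iff₀ hC).1 le_rfl,
      (div_le_iff₀ hD).1 (by linarith)⟩

/-- The polygon cut out by the time-share inequality is convex. -/
lemma convex_setOf_time_share_le_one (A B C D : ℝ) :
    Convex ℝ {p : ℝ × ℝ | 0 ≤ p.1 ∧ 0 ≤ p.2 ∧ p.1 / A + p.2 / C + max (p.1 / B) (p.2 / D) ≤ 1} := by
  rintro ⟨x, y⟩ ⟨hx, hy, h⟩ ⟨x', y'⟩ ⟨hx', hy', h'⟩ s t hs ht hst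
  dsimp only at hx hy h hx' hy' h'
  simp only [Prod.smul_mk, Prod.mk_add_mk, smul_eq_mul, Set.mem_ofPred_eq]
  refine ⟨by positivity, by positivity, ?_⟩
  have hm : max ((s * x + t * x') / B) ((s * y + t * y') / D) ≤
      s * max (x / B) (y / D) + t * max (x' / B) (y' / D) := by
    simp only [add_div, mul_div_assoc]
    apply max_le <;> gcongr <;> simp
  calc _ ≤ (s * x + t * x') / A + (s * y + t * y') / C +
        (s * max (x / B) (y / D) + t * max (x' / B) (y' / D)) := by gcongr
    _ = s * (x / A + y / C + max (x / B) (y / D)) +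
        t * (x' / A + y' / C + max (x' / B) (y' / D)) := by ring
    _ ≤ s * 1 + t * 1 := by gcongr
    _ = 1 := by linarith

/-- The polygon cut out by the time-share inequality is the convex hull of its vertices. -/
lemma setOf_time_share_le_one_eq_convexHull {A B C D : ℝ} (hA : 0 < A) (hB : 0 < B) (hC : 0 < C)
    (hD : 0 < D) :
    {p : ℝ × ℝ | 0 ≤ p.1 ∧ 0 ≤ p.2 ∧ p.1 / A + p.2 / C + max (p.1 / B) (p.2 / D) ≤ 1} =
    convexHull ℝ {((0 : ℝ), (0 : ℝ)), ((1 / A + 1 / B)⁻¹, 0),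
      ((1 / A + 1 / B + D / (C * B))⁻¹, (1 / C + 1 / D + B / (A * D))⁻¹),
      (0, (1 / C + 1 / D)⁻¹)} := by
  have hK : 0 < B / A + D / C + 1 := by positivity
  have hQ₁ : (1 / A + 1 / B + D / (C * B))⁻¹ = B / (B / A + D / C + 1) := by
    field_simp; ring
  have hQ₂ : (1 / C + 1 / D + B / (A * D))⁻¹ = D / (B / A + D / C + 1) := by
    field_simp; ring
  rw [hQ₁, hQ₂]
  apply Set.Subset.antisymm
  · rintro ⟨x, y⟩ ⟨hx, hy, h⟩
    dsimp only at hx hy h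
    have hconv := convex_convexHull ℝ {((0 : ℝ), (0 : ℝ)), ((1 / A + 1 / B)⁻¹, 0),
      (B / (B / A + D / C + 1), D / (B / A + D / C + 1)), (0, (1 / C + 1 / D)⁻¹)}
    rcases le_total (y / D) (x / B) with hle | hle
    · rw [max_eq_left hle] at h
      convert hconv.add_smul_mem_of_zero_mem_s3 (subset_convexHull ℝ _ (Or.inl rfl))
        (p := ((1 / A + 1 / B)⁻¹, 0))
        (q := (B / (B / A + D / C + 1), D / (B / A + D / C + 1)))
        (a := B * (x / B - y / D) * (1 / A + 1 / B)) (b := y / D * (B / A + D / C + 1))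
        (subset_convexHull ℝ _ (by simp)) (subset_convexHull ℝ _ (by simp))
        (mul_nonneg (mul_nonneg hB.le (sub_nonneg.2 hle)) (by positivity)) (by positivity) ?_ using 1
      · ext <;> (simp; field_simp; try ring)
      · convert h using 1
        field_simp
        ring
    · rw [max_eq_right hle] at h
      convert hconv.add_smul_mem_of_zero_mem_s3 (subset_convexHull ℝ _ (Or.inl rfl))
        (p := (0, (1 / C + 1 / D)⁻¹))
        (q := (B / (B / A + D / C + 1), D / (B / A + D / C + 1)))
        (a := D * (y / D - x / B) * (1 / C + 1 / D)) (b := x / B * (B / A + D / C + 1))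
        (subset_convexHull ℝ _ (by simp)) (subset_convexHull ℝ _ (by simp))
        (mul_nonneg (mul_nonneg hD.le (sub_nonneg.2 hle)) (by positivity)) (by positivity) ?_ using 1
      · ext <;> (simp; field_simp; try ring)
      · convert h using 1
        field_simp
        ring
  · refine convexHull_min ?_ (convex_setOf_time_share_le_one A B C D)
    rintro p (rfl | rfl | rfl | rfl)
    · simp
    · refine ⟨by positivity, le_rfl, ?_⟩
      rw [max_eq_left (by simp only [zero_div]; positivity)]
      apply le_of_eq
      field_simp
      ring
    · refine ⟨by positivity, by positivity, ?_⟩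
      rw [max_eq_left (by apply le_of_eq; field_simp)]
      apply le_of_eq
      field_simp
    · refine ⟨le_rfl, by positivity, ?_⟩
      rw [max_eq_right (by simp only [zero_div]; positivity)]
      apply le_of_eq
      field_simp
      ring


/-- Theorem 3 (Achievable rate region of PLNC): `R_PLNC` is the convex hull of
`(0,0)`, `(Σ_AB,0)`, `(Σ_ABA,Σ_BAB)`, `(0,Σ_BA)`, i.e.
`{(x,y) : x ≥ 0, y ≥ 0, x/C_AD + y/C_BD + max{x/C_DB, y/C_DA} ≤ 1}`. -/
theorem plnc_rate_region (C_AD C_DB C_BD C_DA : ℝ)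
    (hAD : 0 < C_AD) (hDB : 0 < C_DB) (hBD : 0 < C_BD) (hDA : 0 < C_DA) :
    let S_AB : ℝ := (1 / C_AD + 1 / C_DB)⁻¹
    let S_BA : ℝ := (1 / C_BD + 1 / C_DA)⁻¹
    let S_ABA : ℝ := (1 / C_AD + 1 / C_DB + C_DA / (C_BD * C_DB))⁻¹
    let S_BAB : ℝ := (1 / C_BD + 1 / C_DA + C_DB / (C_AD * C_DA))⁻¹
    let R_PLNC : Set (ℝ × ℝ) := {p | 0 ≤ p.1 ∧ 0 ≤ p.2 ∧
      ∃ l1 l2 l3 : ℝ, l1 ∈ Set.Icc (0 : ℝ) 1 ∧ l2 ∈ Set.Icc (0 : ℝ) 1 ∧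
        l3 ∈ Set.Icc (0 : ℝ) 1 ∧ l1 + l2 + l3 = 1 ∧
        p.1 ≤ l1 * C_AD ∧ p.1 ≤ l3 * C_DB ∧ p.2 ≤ l2 * C_BD ∧ p.2 ≤ l3 * C_DA}
    R_PLNC = convexHull ℝ {((0 : ℝ), (0 : ℝ)), (S_AB, 0), (S_ABA, S_BAB), (0, S_BA)} ∧
    R_PLNC = {p : ℝ × ℝ | 0 ≤ p.1 ∧ 0 ≤ p.2 ∧
      p.1 / C_AD + p.2 / C_BD + max (p.1 / C_DB) (p.2 / C_DA) ≤ 1} := by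
  intro S_AB S_BA S_ABA S_BAB R_PLNC
  have hR : R_PLNC = {p : ℝ × ℝ | 0 ≤ p.1 ∧ 0 ≤ p.2 ∧
      p.1 / C_AD + p.2 / C_BD + max (p.1 / C_DB) (p.2 / C_DA) ≤ 1} :=
    Set.ext fun p => and_congr_right fun hx => and_congr_right fun hy =>
      exists_time_shares_iff hAD hDB hBD hDA hx hy
  exact ⟨hR.trans (setOf_time_share_le_one_eq_convexHull hAD hDB hBD hDA), hR⟩
end

section
/- PLNC dominates TDMH and MLNC (Remark 2): The PLNC rate region R_PLNC is a convex set, and both the TDMH rate region R_TDMH and the MLNC rate region R_MLNC are contained in R_PLNC; consequently the convex hull of R_TDMH ∪ R_MLNC is contained in R_PLNC. -/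
/-- Remark 2 (PLNC dominates TDMH and MLNC): `R_PLNC` is convex and contains both
`R_TDMH` and `R_MLNC`; consequently `convexHull (R_TDMH ∪ R_MLNC) ⊆ R_PLNC`. -/
theorem plnc_dominates_tdmh_mlnc (C_AD C_DB C_BD C_DA : ℝ)
    (hAD : 0 < C_AD) (hDB : 0 < C_DB) (hBD : 0 < C_BD) (hDA : 0 < C_DA) :
    let C_min : ℝ := min C_DA C_DB
    let R_TDMH : Set (ℝ × ℝ) := {p | 0 ≤ p.1 ∧ 0 ≤ p.2 ∧
      ∃ l1 l2 l3 l4 : ℝ, l1 ∈ Set.Icc (0 : ℝ) 1 ∧ l2 ∈ Set.Icc (0 : ℝ) 1 ∧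
        l3 ∈ Set.Icc (0 : ℝ) 1 ∧ l4 ∈ Set.Icc (0 : ℝ) 1 ∧
        l1 + l2 + l3 + l4 = 1 ∧
        p.1 ≤ l1 * C_AD ∧ p.1 ≤ l2 * C_DB ∧ p.2 ≤ l3 * C_BD ∧ p.2 ≤ l4 * C_DA}
    let R_MLNC : Set (ℝ × ℝ) := {p | 0 ≤ p.1 ∧ 0 ≤ p.2 ∧
      ∃ l1 l2 l3 : ℝ, l1 ∈ Set.Icc (0 : ℝ) 1 ∧ l2 ∈ Set.Icc (0 : ℝ) 1 ∧
        l3 ∈ Set.Icc (0 : ℝ) 1 ∧ l1 + l2 + l3 = 1 ∧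
        p.1 ≤ l1 * C_AD ∧ p.1 ≤ l3 * C_min ∧ p.2 ≤ l2 * C_BD ∧ p.2 ≤ l3 * C_min}
    let R_PLNC : Set (ℝ × ℝ) := {p | 0 ≤ p.1 ∧ 0 ≤ p.2 ∧
      ∃ l1 l2 l3 : ℝ, l1 ∈ Set.Icc (0 : ℝ) 1 ∧ l2 ∈ Set.Icc (0 : ℝ) 1 ∧
        l3 ∈ Set.Icc (0 : ℝ) 1 ∧ l1 + l2 + l3 = 1 ∧
        p.1 ≤ l1 * C_AD ∧ p.1 ≤ l3 * C_DB ∧ p.2 ≤ l2 * C_BD ∧ p.2 ≤ l3 * C_DA}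
    Convex ℝ R_PLNC ∧ R_TDMH ⊆ R_PLNC ∧ R_MLNC ⊆ R_PLNC ∧
      convexHull ℝ (R_TDMH ∪ R_MLNC) ⊆ R_PLNC := by
  intro C_min R_TDMH R_MLNC R_PLNC
  have hconv : Convex ℝ R_PLNC := by
    rintro p ⟨hp1, hp2, l1, l2, l3, hl1, hl2, hl3, hl, h1, h2, h3, h4⟩
      q ⟨hq1, hq2, m1, m2, m3, hm1, hm2, hm3, hm, k1, k2, k3, k4⟩ a b ha hb hab
    have comb {x y l m C : ℝ} (hx : x ≤ l * C) (hy : y ≤ m * C) :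
        a * x + b * y ≤ (a * l + b * m) * C := by
      linarith [mul_le_mul_of_nonneg_left hx ha, mul_le_mul_of_nonneg_left hy hb]
    exact ⟨add_nonneg (mul_nonneg ha hp1) (mul_nonneg hb hq1),
      add_nonneg (mul_nonneg ha hp2) (mul_nonneg hb hq2),
      a * l1 + b * m1, a * l2 + b * m2, a * l3 + b * m3,
      convex_Icc 0 1 hl1 hm1 ha hb hab, convex_Icc 0 1 hl2 hm2 ha hb hab,
      convex_Icc 0 1 hl3 hm3 ha hb hab, by linear_combination a * hl + b * hm + hab,
      comb h1 k1, comb h2 k2, comb h3 k3, comb h4 k4⟩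
  have hTDMH : R_TDMH ⊆ R_PLNC := by
    rintro p ⟨hp1, hp2, l1, l2, l3, l4, hl1, hl2, hl3, hl4, hl, h1, h2, h3, h4⟩
    refine ⟨hp1, hp2, l1, l3, l2 + l4, hl1, hl3,
      ⟨add_nonneg hl2.1 hl4.1, by linarith [hl1.1, hl3.1]⟩, by linarith, h1, ?_, h3, ?_⟩
    · linarith [mul_nonneg hl4.1 hDB.le]
    · linarith [mul_nonneg hl2.1 hDA.le]
  have hMLNC : R_MLNC ⊆ R_PLNC := by
    rintro p ⟨hp1, hp2, l1, l2, l3, hl1, hl2, hl3, hl, h1, h2, h3, h4⟩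
    exact ⟨hp1, hp2, l1, l2, l3, hl1, hl2, hl3, hl, h1,
      h2.trans (mul_le_mul_of_nonneg_left (min_le_right _ _) hl3.1), h3,
      h4.trans (mul_le_mul_of_nonneg_left (min_le_left _ _) hl3.1)⟩
  exact ⟨hconv, hTDMH, hMLNC, convexHull_min (Set.union_subset hTDMH hMLNC) hconv⟩
end

section
/- Corollary 1(a) (Maximum sum rate of TDMH): The supremum of x + y over all (x,y) in the TDMH rate region R_TDMH equals max{Σ_AB, Σ_BA}. -/
/-- A two-hop flow using time shares `a` and `b` on links of capacities `C` and `D` carries at most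
`a + b` times the harmonic combination of the capacities. -/
lemma le_add_mul_harmonic {C D a b x : ℝ} (hC : 0 < C) (hD : 0 < D)
    (ha : x ≤ a * C) (hb : x ≤ b * D) : x ≤ (a + b) * (1 / C + 1 / D)⁻¹ := by
  rw [← div_eq_mul_inv, le_div_iff₀ (by positivity), mul_add, mul_one_div, mul_one_div]
  exact add_le_add ((div_le_iff₀ hC).2 ha) ((div_le_iff₀ hD).2 hb)

/-- Some split of the whole time between two links makes both carry exactly the harmonic
combination of their capacities. -/
lemma exists_time_sharing_eq {C D : ℝ} (hC : 0 < C) (hD : 0 < D) :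
    ∃ a b : ℝ, a ∈ Set.Icc (0 : ℝ) 1 ∧ b ∈ Set.Icc (0 : ℝ) 1 ∧ a + b = 1 ∧
      (1 / C + 1 / D)⁻¹ = a * C ∧ (1 / C + 1 / D)⁻¹ = b * D := by
  have hsum : D / (C + D) + C / (C + D) = 1 := by field_simp; ring
  have ha : 0 ≤ D / (C + D) := by positivity
  have hb : 0 ≤ C / (C + D) := by positivity
  refine ⟨D / (C + D), C / (C + D), ⟨ha, by linarith⟩, ⟨hb, by linarith⟩, hsum, ?_, ?_⟩
  all_goals
    field_simp
    ring


/-- Corollary 1(a): the maximum sum rate of TDMH is `max {Σ_AB, Σ_BA}`. -/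
theorem tdmh_max_sum_rate (C_AD C_DB C_BD C_DA : ℝ)
    (hAD : 0 < C_AD) (hDB : 0 < C_DB) (hBD : 0 < C_BD) (hDA : 0 < C_DA) :
    let S_AB : ℝ := (1 / C_AD + 1 / C_DB)⁻¹
    let S_BA : ℝ := (1 / C_BD + 1 / C_DA)⁻¹
    let R_TDMH : Set (ℝ × ℝ) := {p | 0 ≤ p.1 ∧ 0 ≤ p.2 ∧
      ∃ l1 l2 l3 l4 : ℝ, l1 ∈ Set.Icc (0 : ℝ) 1 ∧ l2 ∈ Set.Icc (0 : ℝ) 1 ∧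
        l3 ∈ Set.Icc (0 : ℝ) 1 ∧ l4 ∈ Set.Icc (0 : ℝ) 1 ∧
        l1 + l2 + l3 + l4 = 1 ∧
        p.1 ≤ l1 * C_AD ∧ p.1 ≤ l2 * C_DB ∧ p.2 ≤ l3 * C_BD ∧ p.2 ≤ l4 * C_DA}
    sSup ((fun p : ℝ × ℝ => p.1 + p.2) '' R_TDMH) = max S_AB S_BA := by
  intro S_AB S_BA R_TDMH
  refine IsGreatest.csSup_eq ⟨?_, ?_⟩
  · obtain ⟨a, b, ha, hb, hab, hxa, hxb⟩ := exists_time_sharing_eq hAD hDB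
    obtain ⟨c, d, hc, hd, hcd, hyc, hyd⟩ := exists_time_sharing_eq hBD hDA
    have h0 : (0 : ℝ) ∈ Set.Icc (0 : ℝ) 1 := by simp
    rcases le_total S_AB S_BA with h | h
    · refine ⟨(0, S_BA), ⟨le_rfl, by positivity, 0, 0, c, d, h0, h0, hc, hd, by linarith,
        by simp, by simp, hyc.le, hyd.le⟩, ?_⟩
      simp [max_eq_right h]
    · refine ⟨(S_AB, 0), ⟨by positivity, le_rfl, a, b, 0, 0, ha, hb, h0, h0, by linarith,
        hxa.le, hxb.le, by simp, by simp⟩, ?_⟩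
      simp [max_eq_left h]
  · rintro _ ⟨⟨x, y⟩, ⟨-, -, a, b, c, d, ha, hb, hc, hd, hsum, hxa, hxb, hyc, hyd⟩, rfl⟩
    have hx : x ≤ (a + b) * S_AB := le_add_mul_harmonic hAD hDB hxa hxb
    have hy : y ≤ (c + d) * S_BA := le_add_mul_harmonic hBD hDA hyc hyd
    calc x + y ≤ (a + b) * S_AB + (c + d) * S_BA := add_le_add hx hy
      _ ≤ (a + b) * max S_AB S_BA + (c + d) * max S_AB S_BA :=
        add_le_add
          (mul_le_mul_of_nonneg_left (le_max_left _ _) (add_nonneg ha.1 hb.1))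
          (mul_le_mul_of_nonneg_left (le_max_right _ _) (add_nonneg hc.1 hd.1))
      _ = max S_AB S_BA := by rw [← add_mul, ← add_assoc, hsum, one_mul]
end

section
/- Corollary 1(b) (Maximum sum rate of MLNC): If C_DB < C_DA, then the supremum of x + y over all (x,y) in the MLNC rate region R_MLNC equals max{Σ_AB, Σ_BB, 2·Σ_min}; if C_DB ≥ C_DA, then this supremum equals max{Σ_BA, Σ_AA, 2·Σ_min}. -/
/-- The rate pairs reachable when the uplinks have capacities `a`, `b` and the broadcast slot has
capacity `m`. -/
def mlncRegion (a b m : ℝ) : Set (ℝ × ℝ) :=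
  {p | 0 ≤ p.1 ∧ 0 ≤ p.2 ∧
    ∃ l1 l2 l3 : ℝ, l1 ∈ Set.Icc (0 : ℝ) 1 ∧ l2 ∈ Set.Icc (0 : ℝ) 1 ∧
      l3 ∈ Set.Icc (0 : ℝ) 1 ∧ l1 + l2 + l3 = 1 ∧
      p.1 ≤ l1 * a ∧ p.1 ≤ l3 * m ∧ p.2 ≤ l2 * b ∧ p.2 ≤ l3 * m}

/-- Eliminating the time shares leaves a single time budget. -/
theorem mem_mlncRegion_iff {a b m x y : ℝ} (ha : 0 < a) (hb : 0 < b) (hm : 0 < m) :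
    (x, y) ∈ mlncRegion a b m ↔ 0 ≤ x ∧ 0 ≤ y ∧ x / a + y / b + max x y / m ≤ 1 := by
  constructor
  · rintro ⟨hx, hy, l1, l2, l3, -, -, -, hl, h1, h2, h3, h4⟩
    refine ⟨hx, hy, ?_⟩
    have e1 : x / a ≤ l1 := (div_le_iff₀ ha).2 h1
    have e2 : y / b ≤ l2 := (div_le_iff₀ hb).2 h3
    have e3 : max x y / m ≤ l3 := (div_le_iff₀ hm).2 (max_le h2 h4)
    linarith
  · rintro ⟨hx, hy, h⟩
    have e1 : 0 ≤ x / a := by positivity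
    have e2 : 0 ≤ y / b := by positivity
    have e3 : 0 ≤ max x y / m := div_nonneg (hx.trans (le_max_left x y)) hm.le
    refine ⟨hx, hy, x / a, y / b, 1 - x / a - y / b, ⟨e1, by linarith⟩, ⟨e2, by linarith⟩,
      ⟨by linarith, by linarith⟩, by ring, (div_mul_cancel₀ x ha.ne').ge, ?_,
      (div_mul_cancel₀ y hb.ne').ge, ?_⟩
    · exact (le_max_left x y).trans ((div_le_iff₀ hm).1 (by linarith))
    · exact (le_max_right x y).trans ((div_le_iff₀ hm).1 (by linarith))

theorem isGreatest_sum_mlncRegion {a b m : ℝ} (ha : 0 < a) (hb : 0 < b) (hm : 0 < m) :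
    IsGreatest ((fun p : ℝ × ℝ => p.1 + p.2) '' mlncRegion a b m)
      (max (max (1 / a + 1 / m)⁻¹ (1 / b + 1 / m)⁻¹) (2 * (1 / a + 1 / b + 1 / m)⁻¹)) := by
  have hu : 0 < 1 / a + 1 / m := by positivity
  have hv : 0 < 1 / b + 1 / m := by positivity
  have hw : 0 < 1 / a + 1 / b + 1 / m := by positivity
  constructor
  · have hA : (1 / a + 1 / m)⁻¹ ∈ (fun p : ℝ × ℝ => p.1 + p.2) '' mlncRegion a b m := by
      refine ⟨((1 / a + 1 / m)⁻¹, 0),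
        (mem_mlncRegion_iff ha hb hm).2 ⟨by positivity, le_rfl, ?_⟩, add_zero _⟩
      rw [max_eq_left (by positivity)]
      linear_combination inv_mul_cancel₀ hu.ne'
    have hB : (1 / b + 1 / m)⁻¹ ∈ (fun p : ℝ × ℝ => p.1 + p.2) '' mlncRegion a b m := by
      refine ⟨(0, (1 / b + 1 / m)⁻¹),
        (mem_mlncRegion_iff ha hb hm).2 ⟨le_rfl, by positivity, ?_⟩, zero_add _⟩
      rw [max_eq_right (by positivity)]
      linear_combination inv_mul_cancel₀ hv.ne'
    have hC : 2 * (1 / a + 1 / b + 1 / m)⁻¹ ∈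
        (fun p : ℝ × ℝ => p.1 + p.2) '' mlncRegion a b m := by
      refine ⟨((1 / a + 1 / b + 1 / m)⁻¹, (1 / a + 1 / b + 1 / m)⁻¹),
        (mem_mlncRegion_iff ha hb hm).2 ⟨by positivity, by positivity, ?_⟩, (two_mul _).symm⟩
      rw [max_self]
      linear_combination inv_mul_cancel₀ hw.ne'
    exact max_rec' (· ∈ _) (max_rec' (· ∈ _) hA hB) hC
  · rintro _ ⟨⟨x, y⟩, hp, rfl⟩
    obtain ⟨hx, hy, h⟩ := (mem_mlncRegion_iff ha hb hm).1 hp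
    set M := max (max (1 / a + 1 / m)⁻¹ (1 / b + 1 / m)⁻¹) (2 * (1 / a + 1 / b + 1 / m)⁻¹)
    have hAM : 1 ≤ M * (1 / a + 1 / m) :=
      (inv_le_iff_one_le_mul₀ hu).1 ((le_max_left _ _).trans (le_max_left _ _))
    have hBM : 1 ≤ M * (1 / b + 1 / m) :=
      (inv_le_iff_one_le_mul₀ hv).1 ((le_max_right _ _).trans (le_max_left _ _))
    have hCM : 2 ≤ M * (1 / a + 1 / b + 1 / m) := by
      rw [← div_le_iff₀ hw, div_eq_mul_inv]
      exact le_max_right _ _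
    have hM0 : 0 ≤ M := le_max_of_le_right (by positivity)
    have hbudget := mul_le_mul_of_nonneg_left h hM0
    change x + y ≤ M
    rcases le_total y x with hyx | hxy
    · rw [max_eq_left hyx] at hbudget
      linear_combination hbudget + mul_le_mul_of_nonneg_left hAM (sub_nonneg.2 hyx) +
        mul_le_mul_of_nonneg_left hCM hy
    · rw [max_eq_right hxy] at hbudget
      linear_combination hbudget + mul_le_mul_of_nonneg_left hBM (sub_nonneg.2 hxy) +
        mul_le_mul_of_nonneg_left hCM hx


/-- Corollary 1(b): the maximum sum rate of MLNC is `max {Σ_AB, Σ_BB, 2Σ_min}` when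
`C_DB < C_DA`, and `max {Σ_BA, Σ_AA, 2Σ_min}` when `C_DB ≥ C_DA`. -/
theorem mlnc_max_sum_rate (C_AD C_DB C_BD C_DA : ℝ)
    (hAD : 0 < C_AD) (hDB : 0 < C_DB) (hBD : 0 < C_BD) (hDA : 0 < C_DA) :
    let C_min : ℝ := min C_DA C_DB
    let S_AB : ℝ := (1 / C_AD + 1 / C_DB)⁻¹
    let S_BA : ℝ := (1 / C_BD + 1 / C_DA)⁻¹
    let S_AA : ℝ := (1 / C_AD + 1 / C_DA)⁻¹
    let S_BB : ℝ := (1 / C_BD + 1 / C_DB)⁻¹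
    let S_min : ℝ := (1 / C_AD + 1 / C_BD + 1 / C_min)⁻¹
    let R_MLNC : Set (ℝ × ℝ) := {p | 0 ≤ p.1 ∧ 0 ≤ p.2 ∧
      ∃ l1 l2 l3 : ℝ, l1 ∈ Set.Icc (0 : ℝ) 1 ∧ l2 ∈ Set.Icc (0 : ℝ) 1 ∧
        l3 ∈ Set.Icc (0 : ℝ) 1 ∧ l1 + l2 + l3 = 1 ∧
        p.1 ≤ l1 * C_AD ∧ p.1 ≤ l3 * C_min ∧ p.2 ≤ l2 * C_BD ∧ p.2 ≤ l3 * C_min}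
    (C_DB < C_DA →
      sSup ((fun p : ℝ × ℝ => p.1 + p.2) '' R_MLNC) = max (max S_AB S_BB) (2 * S_min)) ∧
    (C_DA ≤ C_DB →
      sSup ((fun p : ℝ × ℝ => p.1 + p.2) '' R_MLNC) = max (max S_BA S_AA) (2 * S_min)) := by
  intro C_min S_AB S_BA S_AA S_BB S_min R_MLNC
  have hsup := (isGreatest_sum_mlncRegion hAD hBD (lt_min hDA hDB)).csSup_eq
  constructor
  · intro h
    refine hsup.trans ?_
    simp only [S_AB, S_BB, S_min, C_min, min_eq_right h.le]
  · intro h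
    refine hsup.trans ?_
    simp only [S_BA, S_AA, S_min, C_min, min_eq_left h]
    rw [max_comm (1 / C_AD + 1 / C_DA)⁻¹]
end

section
/- Corollary 2, TDMH (Maximum sum rate under a fixed traffic pattern): For every μ > 0, the supremum of x + y over all (x,y) in the TDMH rate region R_TDMH satisfying y = μ·x equals (1+μ)/(1/Σ_AB + μ/Σ_BA) = (1+μ)/(1/C_AD + 1/C_DB + μ/C_BD + μ/C_DA). -/
/-- Corollary 2 for TDMH: for every traffic pattern `μ > 0`, the maximum sum rate of TDMH
subject to `y = μ·x` is `(1+μ)/(1/Σ_AB + μ/Σ_BA) = (1+μ)/(1/C_AD + 1/C_DB + μ/C_BD + μ/C_DA)`. -/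
theorem tdmh_max_sum_rate_traffic_pattern (C_AD C_DB C_BD C_DA : ℝ)
    (hAD : 0 < C_AD) (hDB : 0 < C_DB) (hBD : 0 < C_BD) (hDA : 0 < C_DA) :
    let S_AB : ℝ := (1 / C_AD + 1 / C_DB)⁻¹
    let S_BA : ℝ := (1 / C_BD + 1 / C_DA)⁻¹
    let R_TDMH : Set (ℝ × ℝ) := {p | 0 ≤ p.1 ∧ 0 ≤ p.2 ∧
      ∃ l1 l2 l3 l4 : ℝ, l1 ∈ Set.Icc (0 : ℝ) 1 ∧ l2 ∈ Set.Icc (0 : ℝ) 1 ∧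
        l3 ∈ Set.Icc (0 : ℝ) 1 ∧ l4 ∈ Set.Icc (0 : ℝ) 1 ∧
        l1 + l2 + l3 + l4 = 1 ∧
        p.1 ≤ l1 * C_AD ∧ p.1 ≤ l2 * C_DB ∧ p.2 ≤ l3 * C_BD ∧ p.2 ≤ l4 * C_DA}
    ∀ μ : ℝ, 0 < μ →
      sSup ((fun p : ℝ × ℝ => p.1 + p.2) '' {p ∈ R_TDMH | p.2 = μ * p.1})
        = (1 + μ) / (1 / S_AB + μ / S_BA) ∧
      (1 + μ) / (1 / S_AB + μ / S_BA)
        = (1 + μ) / (1 / C_AD + 1 / C_DB + μ / C_BD + μ / C_DA) := by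
  intro S_AB S_BA R_TDMH μ hμ
  set T : ℝ := 1 / C_AD + 1 / C_DB + μ / C_BD + μ / C_DA with hT
  have hTpos : 0 < T := by positivity
  have hS : 1 / S_AB + μ / S_BA = T := by
    simp only [S_AB, S_BA, hT, one_div, div_inv_eq_mul]
    ring
  rw [hS]
  refine ⟨IsGreatest.csSup_eq ⟨?_, ?_⟩, rfl⟩
  · have h1 : 0 ≤ 1 / C_AD / T := by positivity
    have h2 : 0 ≤ 1 / C_DB / T := by positivity
    have h3 : 0 ≤ μ / C_BD / T := by positivity
    have h4 : 0 ≤ μ / C_DA / T := by positivity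
    have hsum : 1 / C_AD / T + 1 / C_DB / T + μ / C_BD / T + μ / C_DA / T = 1 := by
      rw [← add_div, ← add_div, ← add_div, ← hT, div_self hTpos.ne']
    refine ⟨(1 / T, μ * (1 / T)), ⟨⟨by positivity, by positivity, _, _, _, _,
      ⟨h1, by linarith⟩, ⟨h2, by linarith⟩, ⟨h3, by linarith⟩, ⟨h4, by linarith⟩, hsum,
      ?_, ?_, ?_, ?_⟩, rfl⟩, ?_⟩
    all_goals clear_value T
    iterate 4
      · apply le_of_eq
        field_simp
    · dsimp only
      ring
  · rintro _ ⟨⟨x, y⟩, ⟨⟨-, -, l1, l2, l3, l4, -, -, -, -, hsum, h1, h2, h3, h4⟩, hy⟩, rfl⟩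
    dsimp only at h1 h2 h3 h4 hy ⊢
    subst hy
    rw [← div_le_iff₀ hAD] at h1
    rw [← div_le_iff₀ hDB] at h2
    rw [← div_le_iff₀ hBD] at h3
    rw [← div_le_iff₀ hDA] at h4
    have hx : x * T ≤ 1 := by
      calc x * T = x / C_AD + x / C_DB + μ * x / C_BD + μ * x / C_DA := by rw [hT]; ring
        _ ≤ 1 := by linarith
    rw [le_div_iff₀ hTpos]
    calc (x + μ * x) * T = (1 + μ) * (x * T) := by ring
      _ ≤ (1 + μ) * 1 := by gcongr
      _ = 1 + μ := mul_one _
end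

section
/- Corollary 2, MLNC (Maximum sum rate under a fixed traffic pattern): For every μ > 0, the supremum of x + y over all (x,y) in the MLNC rate region R_MLNC satisfying y = μ·x equals (1+μ)/(1/C_AD + μ/C_BD + max{1, μ}/C_min). -/
/-- Corollary 2 for MLNC: for every traffic pattern `μ > 0`, the maximum sum rate of MLNC
subject to `y = μ·x` is `(1+μ)/(1/C_AD + μ/C_BD + max{1,μ}/C_min)`. -/
theorem mlnc_max_sum_rate_traffic_pattern (C_AD C_DB C_BD C_DA : ℝ)
    (hAD : 0 < C_AD) (hDB : 0 < C_DB) (hBD : 0 < C_BD) (hDA : 0 < C_DA) :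
    let C_min : ℝ := min C_DA C_DB
    let R_MLNC : Set (ℝ × ℝ) := {p | 0 ≤ p.1 ∧ 0 ≤ p.2 ∧
      ∃ l1 l2 l3 : ℝ, l1 ∈ Set.Icc (0 : ℝ) 1 ∧ l2 ∈ Set.Icc (0 : ℝ) 1 ∧
        l3 ∈ Set.Icc (0 : ℝ) 1 ∧ l1 + l2 + l3 = 1 ∧
        p.1 ≤ l1 * C_AD ∧ p.1 ≤ l3 * C_min ∧ p.2 ≤ l2 * C_BD ∧ p.2 ≤ l3 * C_min}
    ∀ μ : ℝ, 0 < μ →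
      sSup ((fun p : ℝ × ℝ => p.1 + p.2) '' {p ∈ R_MLNC | p.2 = μ * p.1})
        = (1 + μ) / (1 / C_AD + μ / C_BD + max 1 μ / C_min) := by
  intro C_min R_MLNC μ hμ
  have hmin : 0 < C_min := lt_min hDA hDB
  have hmax : 0 < max 1 μ := lt_max_of_lt_left one_pos
  set a := 1 / C_AD with ha
  set b := μ / C_BD with hb
  set c := max 1 μ / C_min with hc
  have ha0 : 0 < a := by positivity
  have hb0 : 0 < b := by positivity
  have hc0 : 0 < c := by positivity
  have haC : a * C_AD = 1 := div_mul_cancel₀ _ hAD.ne'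
  have hbC : b * C_BD = μ := div_mul_cancel₀ _ hBD.ne'
  have hcC : c * C_min = max 1 μ := div_mul_cancel₀ _ hmin.ne'
  have hD : 0 < a + b + c := by positivity
  refine IsGreatest.csSup_eq ⟨?_, ?_⟩
  · have mem_Icc {t : ℝ} (h0 : 0 ≤ t) (h1 : t ≤ a + b + c) :
        t / (a + b + c) ∈ Set.Icc (0 : ℝ) 1 :=
      ⟨div_nonneg h0 hD.le, div_le_one_of_le₀ h1 hD.le⟩
    refine ⟨(1 / (a + b + c), μ / (a + b + c)), ⟨⟨by positivity, by positivity,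
      a / (a + b + c), b / (a + b + c), c / (a + b + c), mem_Icc ha0.le (by linarith),
      mem_Icc hb0.le (by linarith), mem_Icc hc0.le (by linarith), ?_, ?_, ?_, ?_, ?_⟩, ?_⟩, ?_⟩
    · rw [← add_div, ← add_div, div_self hD.ne']
    · rw [div_mul_eq_mul_div, haC]
    · rw [div_mul_eq_mul_div, hcC]
      exact div_le_div_of_nonneg_right (le_max_left _ _) hD.le
    · rw [div_mul_eq_mul_div, hbC]
    · rw [div_mul_eq_mul_div, hcC]
      exact div_le_div_of_nonneg_right (le_max_right _ _) hD.le
    · exact div_eq_mul_one_div _ _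
    · exact (add_div _ _ _).symm
  · rintro _ ⟨⟨x, y⟩, ⟨⟨hx, -, l1, l2, l3, -, -, -, hsum, h1, h2, h3, h4⟩, hy⟩, rfl⟩
    dsimp only at hx h1 h2 h3 h4 hy ⊢
    subst hy
    have hxa : x * a ≤ l1 := by
      rw [ha, mul_one_div]
      exact (div_le_iff₀ hAD).2 h1
    have hxb : x * b ≤ l2 := by
      rw [hb, ← mul_div_assoc, mul_comm]
      exact (div_le_iff₀ hBD).2 h3
    have hxc : x * c ≤ l3 := by
      rw [hc, ← mul_div_assoc, mul_max_of_nonneg _ _ hx, mul_one, mul_comm x μ]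
      exact (div_le_iff₀ hmin).2 (max_le h2 h4)
    rw [le_div_iff₀ hD]
    calc (x + μ * x) * (a + b + c) = (1 + μ) * (x * a + x * b + x * c) := by ring
      _ ≤ (1 + μ) * 1 := by gcongr; linarith
      _ = 1 + μ := mul_one _
end

section
/- Corollary 2, PLNC (Maximum sum rate under a fixed traffic pattern): For every μ > 0, the supremum of x + y over all (x,y) in the PLNC rate region R_PLNC satisfying y = μ·x equals (1+μ)/(1/C_AD + μ/C_BD + max{μ/C_DA, 1/C_DB}). -/
/-- Corollary 2 for PLNC: for every traffic pattern `μ > 0`, the maximum sum rate of PLNC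
subject to `y = μ·x` is `(1+μ)/(1/C_AD + μ/C_BD + max{μ/C_DA, 1/C_DB})`. -/
theorem plnc_max_sum_rate_traffic_pattern (C_AD C_DB C_BD C_DA : ℝ)
    (hAD : 0 < C_AD) (hDB : 0 < C_DB) (hBD : 0 < C_BD) (hDA : 0 < C_DA) :
    let R_PLNC : Set (ℝ × ℝ) := {p | 0 ≤ p.1 ∧ 0 ≤ p.2 ∧
      ∃ l1 l2 l3 : ℝ, l1 ∈ Set.Icc (0 : ℝ) 1 ∧ l2 ∈ Set.Icc (0 : ℝ) 1 ∧
        l3 ∈ Set.Icc (0 : ℝ) 1 ∧ l1 + l2 + l3 = 1 ∧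
        p.1 ≤ l1 * C_AD ∧ p.1 ≤ l3 * C_DB ∧ p.2 ≤ l2 * C_BD ∧ p.2 ≤ l3 * C_DA}
    ∀ μ : ℝ, 0 < μ →
      sSup ((fun p : ℝ × ℝ => p.1 + p.2) '' {p ∈ R_PLNC | p.2 = μ * p.1})
        = (1 + μ) / (1 / C_AD + μ / C_BD + max (μ / C_DA) (1 / C_DB)) := by
  intro R_PLNC μ hμ
  set M := max (μ / C_DA) (1 / C_DB) with hM
  have hM_pos : 0 < M := lt_max_of_lt_right (by positivity)
  have hμM : μ ≤ M * C_DA := (div_le_iff₀ hDA).1 (le_max_left _ _)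
  have h1M : 1 ≤ M * C_DB := (div_le_iff₀ hDB).1 (le_max_right _ _)
  set D := 1 / C_AD + μ / C_BD + M with hD
  have hD_pos : 0 < D := by positivity
  refine IsGreatest.csSup_eq ⟨?_, ?_⟩
  · set x := 1 / D with hx
    have hx_pos : 0 < x := by positivity
    have hsum : x * (1 / C_AD) + x * (μ / C_BD) + x * M = 1 := by
      rw [← mul_add, ← mul_add, ← hD, hx, one_div_mul_cancel hD_pos.ne']
    have h1 : 0 < x * (1 / C_AD) := by positivity
    have h2 : 0 < x * (μ / C_BD) := by positivity
    have h3 : 0 < x * M := by positivity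
    refine ⟨(x, μ * x), ⟨⟨hx_pos.le, by positivity, x * (1 / C_AD), x * (μ / C_BD), x * M,
      ⟨h1.le, by linarith⟩, ⟨h2.le, by linarith⟩, ⟨h3.le, by linarith⟩, hsum,
      ?_, ?_, ?_, ?_⟩, rfl⟩, ?_⟩
    · exact (by field_simp : x = x * (1 / C_AD) * C_AD).le
    · change x ≤ x * M * C_DB
      nlinarith
    · exact (by field_simp : μ * x = x * (μ / C_BD) * C_BD).le
    · change μ * x ≤ x * M * C_DA
      nlinarith
    · change x + μ * x = (1 + μ) / D
      rw [hx]
      ring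
  · rintro _ ⟨⟨x, y⟩, ⟨⟨hx, -, l1, l2, l3, -, -, -, hsum, h1, h2, h3, h4⟩, hy⟩, rfl⟩
    dsimp only at hx h1 h2 h3 h4 hy ⊢
    subst hy
    have e1 : x * (1 / C_AD) ≤ l1 := by
      rw [mul_one_div]
      exact (div_le_iff₀ hAD).2 h1
    have e2 : x * (μ / C_BD) ≤ l2 := by
      rw [← mul_div_assoc, mul_comm x μ]
      exact (div_le_iff₀ hBD).2 h3
    have e3 : x * M ≤ l3 := by
      rw [hM, mul_max_of_nonneg _ _ hx, mul_one_div, ← mul_div_assoc, mul_comm x μ]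
      exact max_le ((div_le_iff₀ hDA).2 h4) ((div_le_iff₀ hDB).2 h2)
    have hxD : x * D ≤ 1 := by
      rw [hD, mul_add, mul_add]
      linarith
    rw [le_div_iff₀ hD_pos]
    nlinarith
end

section
/- PLNC strictly outperforms TDMH for every traffic pattern (positivity of the network coding gain ρ_PT): For every μ > 0, R*_PLNC(μ) > R*_TDMH(μ), and moreover R*_PLNC(μ) ≥ R*_MLNC(μ). -/
/-- Positivity of the network coding gain `ρ_PT`: for every traffic pattern `μ > 0`,
`R*_PLNC(μ) > R*_TDMH(μ)` and `R*_PLNC(μ) ≥ R*_MLNC(μ)`. -/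
theorem plnc_gain_positive (C_AD C_DB C_BD C_DA : ℝ)
    (hAD : 0 < C_AD) (hDB : 0 < C_DB) (hBD : 0 < C_BD) (hDA : 0 < C_DA) :
    let C_min : ℝ := min C_DA C_DB
    let R_TDMH : ℝ → ℝ := fun μ =>
      (1 + μ) / (1 / C_AD + 1 / C_DB + μ / C_BD + μ / C_DA)
    let R_MLNC : ℝ → ℝ := fun μ =>
      (1 + μ) / (1 / C_AD + μ / C_BD + max 1 μ / C_min)
    let R_PLNC : ℝ → ℝ := fun μ =>
      (1 + μ) / (1 / C_AD + μ / C_BD + max (μ / C_DA) (1 / C_DB))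
    ∀ μ : ℝ, 0 < μ → R_TDMH μ < R_PLNC μ ∧ R_MLNC μ ≤ R_PLNC μ := by
  intro C_min R_TDMH R_MLNC R_PLNC μ hμ
  have hAD' : 0 < 1 / C_AD := by positivity
  have hDB' : 0 < 1 / C_DB := by positivity
  have hBD' : 0 < μ / C_BD := by positivity
  have hDA' : 0 < μ / C_DA := by positivity
  have hmin : 0 < C_min := lt_min hDA hDB
  have hpos : 0 < max (μ / C_DA) (1 / C_DB) := lt_max_of_lt_left hDA'
  constructor
  · refine div_lt_div_of_pos_left (by linarith) (by linarith) ?_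
    have : max (μ / C_DA) (1 / C_DB) < μ / C_DA + 1 / C_DB :=
      max_lt (by linarith) (by linarith)
    linarith
  · refine div_le_div_of_nonneg_left (by linarith) (by linarith) ?_
    have : max (μ / C_DA) (1 / C_DB) ≤ max 1 μ / C_min :=
      max_le
        (div_le_div₀ (by positivity) (le_max_right _ _) hmin (min_le_left _ _))
        (div_le_div₀ (by positivity) (le_max_left _ _) hmin (min_le_right _ _))
    linarith
end

section
/- The MLNC-over-TDMH network coding gain is maximized at symmetric traffic: for all μ > 0, R*_MLNC(μ)/R*_TDMH(μ) ≤ R*_MLNC(1)/R*_TDMH(1); that is, the ratio of the maximum sum rate of MLNC to that of TDMH under traffic pattern μ attains its maximum at μ = 1. -/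
/-- Cross-multiplied comparison of the ratio of schedule lengths at `μ` and at `1`, in terms of
the reciprocal capacities. -/
lemma schedule_length_ratio_le {a b c d m μ : ℝ} (ha : 0 < a) (hb : 0 < b) (hc : 0 < c)
    (hd : 0 < d) (hbm : b ≤ m) (hdm : d ≤ m) (hμ : 0 < μ) :
    (a + b + μ * c + μ * d) / (a + μ * c + max 1 μ * m) ≤
      (a + b + c + d) / (a + c + m) := by
  have hm : 0 < m := hb.trans_le hbm
  have hmax : 0 < max 1 μ := lt_max_of_lt_right hμ
  rw [div_le_div_iff₀ (by positivity) (by positivity)]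
  rcases le_total μ 1 with h | h
  · rw [max_eq_left h]
    have h₁ : 0 ≤ (1 - μ) * (c * (m - b) + d * (a + m)) :=
      mul_nonneg (sub_nonneg.2 h)
        (add_nonneg (mul_nonneg hc.le (sub_nonneg.2 hbm)) (by positivity))
    linarith
  · rw [max_eq_right h]
    have h₁ : 0 ≤ (μ - 1) * (a * (m - d) + b * (c + m)) :=
      mul_nonneg (sub_nonneg.2 h)
        (add_nonneg (mul_nonneg ha.le (sub_nonneg.2 hdm)) (by positivity))
    linarith

/-- The MLNC-over-TDMH network coding gain is maximized at symmetric traffic `μ = 1`: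
for all `μ > 0`, `R*_MLNC(μ)/R*_TDMH(μ) ≤ R*_MLNC(1)/R*_TDMH(1)`. -/
theorem mlnc_gain_max_at_symmetric_traffic (C_AD C_DB C_BD C_DA : ℝ)
    (hAD : 0 < C_AD) (hDB : 0 < C_DB) (hBD : 0 < C_BD) (hDA : 0 < C_DA) :
    let C_min : ℝ := min C_DA C_DB
    let R_TDMH : ℝ → ℝ := fun μ =>
      (1 + μ) / (1 / C_AD + 1 / C_DB + μ / C_BD + μ / C_DA)
    let R_MLNC : ℝ → ℝ := fun μ =>
      (1 + μ) / (1 / C_AD + μ / C_BD + max 1 μ / C_min)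
    ∀ μ : ℝ, 0 < μ → R_MLNC μ / R_TDMH μ ≤ R_MLNC 1 / R_TDMH 1 := by
  intro C_min R_TDMH R_MLNC μ hμ
  have hmin : 0 < C_min := lt_min hDA hDB
  have key := schedule_length_ratio_le (one_div_pos.2 hAD) (one_div_pos.2 hDB)
    (one_div_pos.2 hBD) (one_div_pos.2 hDA)
    (one_div_le_one_div_of_le hmin (min_le_right C_DA C_DB))
    (one_div_le_one_div_of_le hmin (min_le_left C_DA C_DB)) hμ
  have h₁ : (1 + μ) ≠ 0 := by positivity
  have h₂ : (1 + 1 : ℝ) ≠ 0 := by norm_num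
  simp only [R_MLNC, R_TDMH, max_self]
  rw [div_div_div_cancel_left' _ _ h₁, div_div_div_cancel_left' _ _ h₂]
  simpa only [mul_one_div] using key
end

section
/- The PLNC-over-TDMH network coding gain is maximized at μ = C_DA/C_DB: for all μ > 0, R*_PLNC(μ)/R*_TDMH(μ) ≤ R*_PLNC(μ*)/R*_TDMH(μ*) where μ* = C_DA/C_DB; that is, the ratio of the maximum sum rate of PLNC to that of TDMH under traffic pattern μ attains its maximum at μ = C_DA/C_DB. -/
/-- The ratio of total link times without and with network coding is largest at the traffic
ratio `m` at which the two overlapping transmissions take equally long. -/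
theorem time_ratio_le_of_balanced {a b c d m x : ℝ} (ha : 0 < a) (hc : 0 < c) (hd : 0 < d)
    (hm : 0 < m) (hb : m * d = b) (hx : 0 < x) :
    (a + b + x * c + x * d) / (a + x * c + max (x * d) b) ≤
      (a + b + m * c + m * d) / (a + m * c + max (m * d) b) := by
  subst hb
  rw [max_self]
  rcases le_total x m with h | h
  · rw [max_eq_right (by gcongr), div_le_div_iff₀ (by positivity) (by positivity)]
    have : 0 ≤ d * (m - x) * (a + m * d) :=
      mul_nonneg (mul_nonneg hd.le (sub_nonneg.2 h)) (by positivity)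
    linarith
  · rw [max_eq_left (by gcongr), div_le_div_iff₀ (by positivity) (by positivity)]
    have : 0 ≤ m * d * (c + d) * (x - m) := mul_nonneg (by positivity) (sub_nonneg.2 h)
    linarith

/-- The PLNC-over-TDMH network coding gain is maximized at `μ* = C_DA/C_DB`:
for all `μ > 0`, `R*_PLNC(μ)/R*_TDMH(μ) ≤ R*_PLNC(μ*)/R*_TDMH(μ*)`. -/
theorem plnc_gain_max_at_ratio (C_AD C_DB C_BD C_DA : ℝ)
    (hAD : 0 < C_AD) (hDB : 0 < C_DB) (hBD : 0 < C_BD) (hDA : 0 < C_DA) :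
    let R_TDMH : ℝ → ℝ := fun μ =>
      (1 + μ) / (1 / C_AD + 1 / C_DB + μ / C_BD + μ / C_DA)
    let R_PLNC : ℝ → ℝ := fun μ =>
      (1 + μ) / (1 / C_AD + μ / C_BD + max (μ / C_DA) (1 / C_DB))
    ∀ μ : ℝ, 0 < μ →
      R_PLNC μ / R_TDMH μ ≤ R_PLNC (C_DA / C_DB) / R_TDMH (C_DA / C_DB) := by
  intro R_TDMH R_PLNC μ hμ
  have gain_eq : ∀ x : ℝ, 0 < x → R_PLNC x / R_TDMH x =
      (1 / C_AD + 1 / C_DB + x * (1 / C_BD) + x * (1 / C_DA)) /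
        (1 / C_AD + x * (1 / C_BD) + max (x * (1 / C_DA)) (1 / C_DB)) := by
    intro x hx
    simp only [R_TDMH, R_PLNC, mul_one_div]
    exact div_div_div_cancel_left' _ _ (by positivity)
  have hm : 0 < C_DA / C_DB := by positivity
  rw [gain_eq μ hμ, gain_eq _ hm]
  exact time_ratio_le_of_balanced (by positivity) (by positivity) (by positivity) hm
    (by field_simp) hμ
end

section
/- MLNC is not always better than TDMH (Remark 1): If C_DB < C_DA, then for every traffic pattern parameter μ > C_DA/(C_DA − C_DB) one has R*_MLNC(μ) < R*_TDMH(μ); that is, for sufficiently asymmetric traffic the maximum sum rate of MLNC is strictly smaller than that of TDMH. -/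
/-- Remark 1 (MLNC is not always better than TDMH): if `C_DB < C_DA`, then for every
traffic pattern `μ > C_DA/(C_DA − C_DB)` one has `R*_MLNC(μ) < R*_TDMH(μ)`. -/
theorem mlnc_worse_than_tdmh_for_asymmetric_traffic (C_AD C_DB C_BD C_DA : ℝ)
    (hAD : 0 < C_AD) (hDB : 0 < C_DB) (hBD : 0 < C_BD) (hDA : 0 < C_DA)
    (hlt : C_DB < C_DA) :
    let C_min : ℝ := min C_DA C_DB
    let R_TDMH : ℝ → ℝ := fun μ =>
      (1 + μ) / (1 / C_AD + 1 / C_DB + μ / C_BD + μ / C_DA)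
    let R_MLNC : ℝ → ℝ := fun μ =>
      (1 + μ) / (1 / C_AD + μ / C_BD + max 1 μ / C_min)
    ∀ μ : ℝ, C_DA / (C_DA - C_DB) < μ → R_MLNC μ < R_TDMH μ := by
  intro C_min R_TDMH R_MLNC μ hμ
  have hd : 0 < C_DA - C_DB := sub_pos.2 hlt
  have hμ' : C_DA < μ * (C_DA - C_DB) := (div_lt_iff₀ hd).1 hμ
  have h_one : 1 < μ := ((one_lt_div hd).2 (by linarith)).trans hμ
  have h_pos : 0 < μ := one_pos.trans h_one
  have key : 1 / C_DB + μ / C_DA < μ / C_DB := by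
    rw [div_add_div _ _ hDB.ne' hDA.ne', div_lt_div_iff₀ (by positivity) hDB]
    nlinarith [mul_lt_mul_of_pos_left hμ' hDB]
  simp only [R_MLNC, R_TDMH, C_min, min_eq_right hlt.le, max_eq_right h_one.le]
  exact div_lt_div_of_pos_left (by positivity) (by positivity) (by linarith)
end
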